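/- Suppose N(Aᵀ − I) = span(v) with v > 0, and A − I + D is an M-matrix for every nonzero nonnegative diagonal D. If vᵀb < 0, then the absolute value equation Ax − |x| = b has at most one solution. -/

import Mathlib

open Matrix

def IsZMatrix {n : ℕ} (A : Matrix (Fin n) (Fin n) ℝ) : Prop :=
  ∀ i j, i ≠ j → A i j ≤ 0

/-- An M-matrix: a Z-matrix that is invertible with entrywise nonnegative inverse. -/
def IsMMatrix {n : ℕ} (A : Matrix (Fin n) (Fin n) ℝ) : Prop :=
  IsZMatrix A ∧ IsUnit A ∧ ∀ i j, 0 ≤ A⁻¹ i j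

/-- D(x) = diag(sign(x)). -/
noncomputable def signD {n : ℕ} (x : Fin n → ℝ) : Matrix (Fin n) (Fin n) ℝ :=
  Matrix.diagonal (fun i => Real.sign (x i))

/-- Componentwise absolute value. -/
def absVec {n : ℕ} (x : Fin n → ℝ) : Fin n → ℝ := fun i => |x i|

/-- Spectral (operator 2-) norm of a matrix. -/
noncomputable def specNorm {n : ℕ} (A : Matrix (Fin n) (Fin n) ℝ) : ℝ :=
  ‖Matrix.toEuclideanCLM (𝕜 := ℝ) A‖

theorem exists_nonneg_mul_sub_eq (x y : ℝ) :
    ∃ d : ℝ, 0 ≤ d ∧ d * (x - y) = (x - y) - (|x| - |y|) ∧ (x < 0 → d ≠ 0) := by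
  by_cases h : x = y
  · exact ⟨1, by simp [h]⟩
  have hne : x - y ≠ 0 := sub_ne_zero.mpr h
  refine ⟨1 - (|x| - |y|) / (x - y), ?_, by field_simp, fun hx h0 => ?_⟩
  · rw [sub_nonneg]
    refine (le_abs_self _).trans ?_
    rw [abs_div]
    exact div_le_one_of_le₀ (abs_abs_sub_abs_le_abs_sub x y) (abs_nonneg _)
  · have h1 : |x| - |y| = x - y := (div_eq_one_iff_eq hne).mp (sub_eq_zero.mp h0).symm
    rw [abs_of_neg hx] at h1
    rcases abs_cases y with ⟨hy, _⟩ | ⟨hy, _⟩ <;> rw [hy] at h1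
    · linarith
    · exact h (by linarith)

theorem exists_neg_of_mulVec_sub_absVec {n : ℕ} {A : Matrix (Fin n) (Fin n) ℝ}
    {v b x : Fin n → ℝ} (hvA : v ᵥ* A = v) (hb : v ⬝ᵥ b < 0)
    (hx : A.mulVec x - absVec x = b) : ∃ i, x i < 0 := by
  by_contra! h
  have habs : absVec x = x := funext fun i => abs_of_nonneg (h i)
  rw [← hx, habs, dotProduct_sub, dotProduct_mulVec, hvA, sub_self] at hb
  exact lt_irrefl _ hb

theorem stmt_12 {n : ℕ} (A : Matrix (Fin n) (Fin n) ℝ) (v b : Fin n → ℝ)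
    (hker : LinearMap.ker (Matrix.toLin' (Aᵀ - 1)) = Submodule.span ℝ {v})
    (hv : ∀ i, 0 < v i)
    (hM : ∀ d : Fin n → ℝ, (∀ i, 0 ≤ d i) → d ≠ 0 →
      IsMMatrix (A - 1 + Matrix.diagonal d))
    (hb : v ⬝ᵥ b < 0)
    (x y : Fin n → ℝ)
    (hx : A.mulVec x - absVec x = b) (hy : A.mulVec y - absVec y = b) :
    x = y := by
  have hvA : v ᵥ* A = v := by
    have hmem : v ∈ LinearMap.ker (Matrix.toLin' (Aᵀ - 1)) :=
      hker ▸ Submodule.mem_span_singleton_self v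
    rwa [LinearMap.mem_ker, toLin'_apply, sub_mulVec, one_mulVec, mulVec_transpose,
      sub_eq_zero] at hmem
  obtain ⟨i, hi⟩ := exists_neg_of_mulVec_sub_absVec hvA hb hx
  choose d hd0 hd hdne using fun j => exists_nonneg_mul_sub_eq (x j) (y j)
  have hunit := (hM d hd0 fun h => hdne i hi (congrFun h i)).2.1
  have hzero : (A - 1 + diagonal d) *ᵥ (x - y) = 0 := by
    rw [add_mulVec, sub_mulVec, one_mulVec, mulVec_sub]
    ext j
    have hxj := congrFun (hx.trans hy.symm) j
    simp only [Pi.sub_apply, Pi.add_apply, absVec, mulVec_diagonal, Pi.zero_apply] at hxj ⊢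
    linarith [hd j]
  rw [← mulVec_zero (A - 1 + diagonal d)] at hzero
  exact sub_eq_zero.mp (mulVec_injective_of_isUnit hunit hzero)
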